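/- arXiv:2302.13956 — 2 statements merged into one kernel-verified Lean document; each statement's English description precedes it below -/
import Mathlib

section
/- Let n ≥ 3, let Δ be the standard simplex of probability vectors on Fin n, and fix a prior μ in the relative interior of Δ. Suppose a distortion function φ : Δ → Δ respects the Blackwell order for μ and produces an expansive error at some point of Δ (i.e., there exists x ∈ Δ with φ(x) ∉ segment ℝ μ x). Then there exists x* ∈ Δ such that φ(x) = x* for every x in the relative interior of Δ. -/
open Set Finset

/-- The relative interior of the standard simplex: full-support probability vectors. -/
def relintSimplex (n : ℕ) : Set (Fin n → ℝ) :=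
  {x ∈ stdSimplex ℝ (Fin n) | ∀ θ, 0 < x θ}

/-- A distortion `φ` on beliefs in the standard simplex respects the Blackwell order
if for every compact decision problem `(A, u)` and every consistent (interim-optimal)
action choice `a`, the induced payoff function `W` is convex on the simplex. -/
def RespectsBlackwell (n : ℕ) (φ : (Fin n → ℝ) → (Fin n → ℝ)) : Prop :=
  ∀ (A : Type) [TopologicalSpace A] [CompactSpace A] [Nonempty A]
    (u : A → Fin n → ℝ), Continuous u →
    ∀ a : (Fin n → ℝ) → A,
      (∀ y ∈ stdSimplex ℝ (Fin n), ∀ b : A,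
        ∑ θ, y θ * u b θ ≤ ∑ θ, y θ * u (a y) θ) →
      ConvexOn ℝ (stdSimplex ℝ (Fin n)) (fun x => ∑ θ, x θ * u (a (φ x)) θ)

open Module

/-- In the two-action problem with payoffs `0` and `ℓ`, breaking ties in favour of `0`, the
induced payoff function is convex. -/
lemma RespectsBlackwell.convexOn_ite {n : ℕ} {φ : (Fin n → ℝ) → (Fin n → ℝ)}
    (hB : RespectsBlackwell n φ) (ℓ : Dual ℝ (Fin n → ℝ)) :
    ConvexOn ℝ (stdSimplex ℝ (Fin n)) (fun x => if 0 < ℓ (φ x) then ℓ x else 0) := by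
  have hsum (y : Fin n → ℝ) : ∑ θ, y θ * ℓ (Pi.single θ 1) = ℓ y := by
    rw [LinearMap.pi_apply_eq_sum_univ ℓ y]
    refine Finset.sum_congr rfl fun θ _ => ?_
    rw [smul_eq_mul]
    congr 2
    ext i
    simp [Pi.single_apply, eq_comm]
  have h := hB Bool (fun b θ => if b then ℓ (Pi.single θ 1) else 0)
    continuous_of_discreteTopology (fun y => decide (0 < ℓ y)) (by
      intro y _ b
      by_cases hy : 0 < ℓ y
      · cases b <;> simp [hsum, hy, hy.le]
      · cases b <;> simp [hsum, hy, le_of_not_gt hy])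
  refine h.congr fun x _ => ?_
  by_cases hx : 0 < ℓ (φ x) <;> simp [hx, hsum]

/-- A point of the relative interior lies strictly between any point of the simplex and some
other point of the simplex. -/
lemma exists_extension_mem_stdSimplex {n : ℕ} {p x : Fin n → ℝ} (hp : p ∈ relintSimplex n)
    (hx : x ∈ stdSimplex ℝ (Fin n)) :
    ∃ η : ℝ, 0 < η ∧ p + η • (p - x) ∈ stdSimplex ℝ (Fin n) := by
  have hpos : ∀ᶠ η : ℝ in nhdsWithin 0 (Ioi 0), ∀ θ, 0 < p θ + η * (p θ - x θ) := by
    refine Filter.eventually_all.2 fun θ => ?_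
    have hc : Continuous fun η : ℝ => p θ + η * (p θ - x θ) := by fun_prop
    exact nhdsWithin_le_nhds (hc.continuousAt.eventually (lt_mem_nhds (by simpa using hp.2 θ)))
  obtain ⟨η, hη, hη0⟩ := (hpos.and self_mem_nhdsWithin).exists
  refine ⟨η, hη0, fun θ => by simpa using (hη θ).le, ?_⟩
  have h1 := hp.1.2
  have h2 := hx.2
  simp [Finset.sum_add_distrib, ← Finset.mul_sum, Finset.sum_sub_distrib, h1, h2]

section Separation

variable {n : ℕ} {φ : (Fin n → ℝ) → (Fin n → ℝ)}

lemma RespectsBlackwell.pos_of_neg (hB : RespectsBlackwell n φ) {p x : Fin n → ℝ}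
    (hp : p ∈ stdSimplex ℝ (Fin n)) (hx : x ∈ stdSimplex ℝ (Fin n)) (ℓ : Dual ℝ (Fin n → ℝ))
    (hφp : 0 < ℓ (φ p)) (hℓx : 0 < ℓ x) (hℓp : ℓ p < 0) : 0 < ℓ (φ x) := by
  by_contra hneg
  have hd : 0 < ℓ x - ℓ p := by linarith
  have h := (hB.convexOn_ite ℓ).2 hp hx (show 0 ≤ ℓ x / (ℓ x - ℓ p) by positivity)
    (show 0 ≤ -ℓ p / (ℓ x - ℓ p) from div_nonneg (by linarith) hd.le) (by field_simp; ring)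
  have hz : ℓ ((ℓ x / (ℓ x - ℓ p)) • p + (-ℓ p / (ℓ x - ℓ p)) • x) = 0 := by
    simp only [map_add, map_smul, smul_eq_mul]
    field_simp
    ring
  simp only [hz, ite_self, hφp, hneg, if_true, if_false, smul_eq_mul, mul_zero, add_zero] at h
  have : 0 < ℓ x / (ℓ x - ℓ p) := by positivity
  nlinarith

lemma RespectsBlackwell.pos_of_pos (hB : RespectsBlackwell n φ) {p x : Fin n → ℝ}
    (hp : p ∈ relintSimplex n) (hx : x ∈ stdSimplex ℝ (Fin n)) (ℓ : Dual ℝ (Fin n → ℝ))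
    (hφp : 0 < ℓ (φ p)) (hℓx : 0 < ℓ x) (hℓp : 0 < ℓ p) : 0 < ℓ (φ x) := by
  by_contra hneg
  have hconv := hB.convexOn_ite ℓ
  obtain ⟨η, hη, hz⟩ := exists_extension_mem_stdSimplex hp hx
  set z := p + η • (p - x) with hzdef
  obtain ⟨δ, hδ0, hδ1, hδ⟩ : ∃ δ : ℝ, 0 < δ ∧ δ < 1 ∧ δ * |ℓ z| < η * ℓ p := by
    have hpos : 0 < η * ℓ p := by positivity
    have hden : 0 < |ℓ z| + η * ℓ p + 1 := by positivity
    refine ⟨η * ℓ p / (|ℓ z| + η * ℓ p + 1), by positivity, ?_, ?_⟩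
    · rw [div_lt_one hden]
      linarith [abs_nonneg (ℓ z)]
    · rw [div_mul_eq_mul_div, div_lt_iff₀ hden]
      nlinarith
  set w := (1 - δ) • p + δ • x with hwdef
  have hw : w ∈ stdSimplex ℝ (Fin n) :=
    convex_stdSimplex ℝ (Fin n) hp.1 hx (by linarith) hδ0.le (by ring)
  have hφw : ¬ 0 < ℓ (φ w) := by
    intro hpos
    have h := hconv.2 hp.1 hx (show 0 ≤ 1 - δ by linarith) hδ0.le (by ring)
    rw [← hwdef] at h
    simp only [hpos, hφp, hneg, if_true, if_false, smul_eq_mul, mul_zero, add_zero] at h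
    simp only [hwdef, map_add, map_smul, smul_eq_mul] at h
    nlinarith
  have hsum : 0 < η + δ := by positivity
  have hcomb : (η / (η + δ)) • w + (δ / (η + δ)) • z = p := by
    ext θ
    simp only [hwdef, hzdef, Pi.add_apply, Pi.smul_apply, Pi.sub_apply, smul_eq_mul]
    field_simp
    ring
  have h := hconv.2 hw hz (show 0 ≤ η / (η + δ) by positivity)
    (show 0 ≤ δ / (η + δ) by positivity) (by field_simp)
  rw [hcomb] at h
  simp only [hφp, hφw, if_true, if_false, smul_eq_mul, mul_zero, zero_add] at h
  have hle : (if 0 < ℓ (φ z) then ℓ z else 0) ≤ |ℓ z| := by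
    split_ifs
    exacts [le_abs_self _, abs_nonneg _]
  have h' : ℓ p ≤ δ / (η + δ) * |ℓ z| := h.trans (by gcongr)
  rw [div_mul_eq_mul_div, le_div_iff₀ hsum] at h'
  nlinarith

/-- The linear functional summing all coordinates. -/
def sumDual (n : ℕ) : Dual ℝ (Fin n → ℝ) := ∑ θ, LinearMap.proj θ

lemma sumDual_apply_of_mem {x : Fin n → ℝ} (hx : x ∈ stdSimplex ℝ (Fin n)) :
    sumDual n x = 1 := by
  simpa [sumDual] using hx.2

/-- If the distorted belief at some full-support `p` is strictly on the positive side of a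
hyperplane, then every belief strictly on the positive side stays there. -/
lemma RespectsBlackwell.pos (hB : RespectsBlackwell n φ)
    (hφ : MapsTo φ (stdSimplex ℝ (Fin n)) (stdSimplex ℝ (Fin n))) {p x : Fin n → ℝ}
    (hp : p ∈ relintSimplex n) (hx : x ∈ stdSimplex ℝ (Fin n)) (ℓ : Dual ℝ (Fin n → ℝ))
    (hφp : 0 < ℓ (φ p)) (hℓx : 0 < ℓ x) : 0 < ℓ (φ x) := by
  rcases lt_trichotomy (ℓ p) 0 with h | h | h
  · exact hB.pos_of_neg hp.1 hx ℓ hφp hℓx h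
  · have hm : 0 < min (ℓ (φ p)) (ℓ x) := lt_min hφp hℓx
    have hs (y) (hy : y ∈ stdSimplex ℝ (Fin n)) :
        (ℓ - (min (ℓ (φ p)) (ℓ x) / 2) • sumDual n) y = ℓ y - min (ℓ (φ p)) (ℓ x) / 2 := by
      simp [sumDual_apply_of_mem hy]
    have h1 := min_le_left (ℓ (φ p)) (ℓ x)
    have h2 := min_le_right (ℓ (φ p)) (ℓ x)
    have := hB.pos_of_neg hp.1 hx (ℓ - (min (ℓ (φ p)) (ℓ x) / 2) • sumDual n)
      (by rw [hs _ (hφ hp.1)]; linarith) (by rw [hs _ hx]; linarith) (by rw [hs _ hp.1]; linarith)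
    rw [hs _ (hφ hx)] at this
    linarith
  · exact hB.pos_of_pos hp hx ℓ hφp hℓx h

lemma RespectsBlackwell.nonneg (hB : RespectsBlackwell n φ)
    (hφ : MapsTo φ (stdSimplex ℝ (Fin n)) (stdSimplex ℝ (Fin n))) {p x : Fin n → ℝ}
    (hp : p ∈ relintSimplex n) (hx : x ∈ stdSimplex ℝ (Fin n)) (ℓ : Dual ℝ (Fin n → ℝ))
    (hφp : 0 < ℓ (φ p)) (hℓx : ℓ x = 0) : 0 ≤ ℓ (φ x) := by
  by_contra! hneg
  have hs (y) (hy : y ∈ stdSimplex ℝ (Fin n)) :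
      (ℓ + (-ℓ (φ x) / 2) • sumDual n) y = ℓ y - ℓ (φ x) / 2 := by
    simp [sumDual_apply_of_mem hy]
    ring
  have := hB.pos hφ hp hx (ℓ + (-ℓ (φ x) / 2) • sumDual n)
    (by rw [hs _ (hφ hp.1)]; linarith) (by rw [hs _ hx]; linarith)
  rw [hs _ (hφ hx)] at this
  linarith

lemma RespectsBlackwell.eq_zero (hB : RespectsBlackwell n φ)
    (hφ : MapsTo φ (stdSimplex ℝ (Fin n)) (stdSimplex ℝ (Fin n))) {p q x : Fin n → ℝ}
    (hp : p ∈ relintSimplex n) (hq : q ∈ relintSimplex n) (hx : x ∈ stdSimplex ℝ (Fin n))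
    (ℓ : Dual ℝ (Fin n → ℝ)) (hφp : 0 < ℓ (φ p)) (hφq : ℓ (φ q) < 0) (hℓx : ℓ x = 0) :
    ℓ (φ x) = 0 := by
  refine le_antisymm ?_ (hB.nonneg hφ hp hx ℓ hφp hℓx)
  have := hB.nonneg hφ hq hx (-ℓ) (by simpa using hφq) (by simpa using hℓx)
  simpa using this

/-- Two distinct points of the simplex are strictly separated by a hyperplane through any point
outside their span. -/
lemma exists_dual_separating {p q x : Fin n → ℝ} (hp : p ∈ stdSimplex ℝ (Fin n))
    (hq : q ∈ stdSimplex ℝ (Fin n)) (hpq : p ≠ q) (hx : x ∉ Submodule.span ℝ {p, q}) :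
    ∃ ℓ : Dual ℝ (Fin n → ℝ), 0 < ℓ p ∧ ℓ q < 0 ∧ ℓ x = 0 := by
  obtain ⟨f, hfp, hfq⟩ : ∃ f : Dual ℝ (Fin n → ℝ), 0 < f p ∧ f q < 0 := by
    obtain ⟨θ, hθ⟩ := Function.ne_iff.1 hpq
    let f : Dual ℝ (Fin n → ℝ) := LinearMap.proj θ - ((p θ + q θ) / 2) • sumDual n
    have hfp : f p = (p θ - q θ) / 2 := by
      simp [f, sumDual_apply_of_mem hp]
      ring
    have hfq : f q = (q θ - p θ) / 2 := by
      simp [f, sumDual_apply_of_mem hq]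
      ring
    rcases hθ.lt_or_gt with h | h
    · exact ⟨-f, by simp only [LinearMap.neg_apply]; linarith,
        by simp only [LinearMap.neg_apply]; linarith⟩
    · exact ⟨f, by linarith, by linarith⟩
  obtain ⟨g, hgx, hg⟩ := Submodule.exists_le_ker_of_notMem hx
  have hgp : g p = 0 := hg (Submodule.subset_span (by simp))
  have hgq : g q = 0 := hg (Submodule.subset_span (by simp))
  refine ⟨f - (f x / g x) • g, by simpa [hgp], by simpa [hgq], ?_⟩
  simp [div_mul_cancel₀ _ hgx]

lemma RespectsBlackwell.eq_self_of_notMem_span (hB : RespectsBlackwell n φ)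
    (hφ : MapsTo φ (stdSimplex ℝ (Fin n)) (stdSimplex ℝ (Fin n))) {p q x : Fin n → ℝ}
    (hp : p ∈ relintSimplex n) (hq : q ∈ relintSimplex n) (hx : x ∈ stdSimplex ℝ (Fin n))
    (hpq : φ p ≠ φ q) (hspan : x ∉ Submodule.span ℝ {φ p, φ q}) : φ x = x := by
  obtain ⟨ℓ, hℓp, hℓq, hℓx⟩ := exists_dual_separating (hφ hp.1) (hφ hq.1) hpq hspan
  have hy := hB.eq_zero hφ hp hq hx ℓ hℓp hℓq hℓx
  ext θ
  let e : Dual ℝ (Fin n → ℝ) := LinearMap.proj θ - x θ • sumDual n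
  have he (y) (hy : y ∈ stdSimplex ℝ (Fin n)) : e y = y θ - x θ := by
    simp [e, sumDual_apply_of_mem hy]
  have habs (y) (hy : y ∈ stdSimplex ℝ (Fin n)) : |e y| ≤ 1 := by
    have h1 := (mem_Icc_of_mem_stdSimplex hy θ).2
    have h2 := (mem_Icc_of_mem_stdSimplex hx θ).2
    rw [he y hy, abs_le]
    constructor <;> linarith [hy.1 θ, hx.1 θ]
  set ε := min (ℓ (φ p)) (-ℓ (φ q)) / 2 with hε
  have hε0 : 0 < ε := half_pos (lt_min hℓp (by linarith))
  have h1 := min_le_left (ℓ (φ p)) (-ℓ (φ q))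
  have h2 := min_le_right (ℓ (φ p)) (-ℓ (φ q))
  have hep := abs_le.1 (habs _ (hφ hp.1))
  have heq := abs_le.1 (habs _ (hφ hq.1))
  have h := hB.eq_zero hφ hp hq hx (ℓ + ε • e)
    (by simp only [LinearMap.add_apply, LinearMap.smul_apply, smul_eq_mul]; nlinarith)
    (by simp only [LinearMap.add_apply, LinearMap.smul_apply, smul_eq_mul]; nlinarith)
    (by simp [hℓx, he x hx])
  simp only [LinearMap.add_apply, LinearMap.smul_apply, smul_eq_mul, hy, zero_add, mul_eq_zero,
    hε0.ne', false_or, he _ (hφ hx)] at h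
  linarith

end Separation

/-- With at least three states, some full-support belief avoids any given plane through `0`. -/
lemma exists_relintSimplex_notMem_span {n : ℕ} (hn : 3 ≤ n) {μ : Fin n → ℝ}
    (hμ : μ ∈ relintSimplex n) (p q : Fin n → ℝ) :
    ∃ z ∈ relintSimplex n, z ∉ Submodule.span ℝ {p, q} := by
  by_cases hμs : μ ∈ Submodule.span ℝ {p, q}
  swap
  · exact ⟨μ, hμ, hμs⟩
  obtain ⟨θ, hθ⟩ : ∃ θ : Fin n, Pi.single θ (1 : ℝ) ∉ Submodule.span ℝ {p, q} := by
    by_contra! h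
    have htop : Submodule.span ℝ {p, q} = ⊤ := by
      rw [eq_top_iff, ← (Pi.basisFun ℝ (Fin n)).span_eq, Submodule.span_le]
      rintro _ ⟨θ, rfl⟩
      simpa using h θ
    have h1 := finrank_span_finset_le_card (R := ℝ) ({p, q} : Finset (Fin n → ℝ))
    have h2 : #({p, q} : Finset (Fin n → ℝ)) ≤ 2 := Finset.card_le_two
    rw [Set.finrank, Finset.coe_pair, htop, finrank_top, Module.finrank_fin_fun] at h1
    omega
  refine ⟨(1 / 2 : ℝ) • μ + (1 / 2 : ℝ) • Pi.single θ (1 : ℝ), ⟨?_, fun i => ?_⟩, fun h => hθ ?_⟩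
  · exact convex_stdSimplex ℝ (Fin n) hμ.1 (single_mem_stdSimplex ℝ θ) (by norm_num) (by norm_num)
      (by norm_num)
  · have h1 := hμ.2 i
    have h2 := (single_mem_stdSimplex ℝ θ).1 i
    simp only [Pi.add_apply, Pi.smul_apply, smul_eq_mul]
    linarith
  · exact (Submodule.smul_mem_iff _ (by norm_num)).1
      ((Submodule.add_mem_iff_right _ (Submodule.smul_mem _ (1 / 2 : ℝ) hμs)).1 h)

/-- Two lines through `z`, and `p` and `q` respectively, meet the line through `p` and `q` only at
those points. -/
lemma notMem_span_pair_or {n : ℕ} {p q x z : Fin n → ℝ} (hp : p ∈ stdSimplex ℝ (Fin n))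
    (hq : q ∈ stdSimplex ℝ (Fin n)) (hx : x ∈ stdSimplex ℝ (Fin n)) (hpq : p ≠ q)
    (hz : z ∉ Submodule.span ℝ {p, q}) (hxs : x ∈ Submodule.span ℝ {p, q}) :
    x ∉ Submodule.span ℝ {z, p} ∨ x ∉ Submodule.span ℝ {z, q} := by
  have key {r : Fin n → ℝ} (hr : r ∈ stdSimplex ℝ (Fin n)) (hrs : r ∈ Submodule.span ℝ {p, q})
      (h : x ∈ Submodule.span ℝ {z, r}) : x = r := by
    obtain ⟨a, b, rfl⟩ := Submodule.mem_span_pair.1 h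
    have ha : a = 0 := by
      by_contra ha
      exact hz ((Submodule.smul_mem_iff _ ha).1
        ((Submodule.add_mem_iff_left _ (Submodule.smul_mem _ b hrs)).1 hxs))
    have h1 := sumDual_apply_of_mem hx
    simp only [map_add, map_smul, ha, sumDual_apply_of_mem hr, smul_eq_mul] at h1
    have hb : b = 1 := by linarith
    simp [ha, hb]
  by_contra! h
  exact hpq ((key hp (Submodule.subset_span (by simp)) h.1).symm.trans
    (key hq (Submodule.subset_span (by simp)) h.2))

theorem expansive_error_implies_stubborn
    (n : ℕ) (hn : 3 ≤ n)
    (μ : Fin n → ℝ) (hμ : μ ∈ relintSimplex n)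
    (φ : (Fin n → ℝ) → (Fin n → ℝ))
    (hφ : MapsTo φ (stdSimplex ℝ (Fin n)) (stdSimplex ℝ (Fin n)))
    (hB : RespectsBlackwell n φ)
    (hexp : ∃ x ∈ stdSimplex ℝ (Fin n), φ x ∉ segment ℝ μ x) :
    ∃ xs ∈ stdSimplex ℝ (Fin n), ∀ x ∈ relintSimplex n, φ x = xs := by
  obtain ⟨x, hx, hxexp⟩ := hexp
  refine ⟨φ μ, hφ hμ.1, ?_⟩
  by_contra! hne
  obtain ⟨p, hp, hpμ⟩ := hne
  suffices φ x = x from hxexp (by rw [this]; exact right_mem_segment ℝ μ x)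
  by_cases hxs : x ∈ Submodule.span ℝ {φ p, φ μ}
  swap
  · exact hB.eq_self_of_notMem_span hφ hp hμ hx hpμ hxs
  obtain ⟨z, hz, hzs⟩ := exists_relintSimplex_notMem_span hn hμ (φ p) (φ μ)
  have hφz : φ z = z := hB.eq_self_of_notMem_span hφ hp hμ hz.1 hpμ hzs
  have hzne {r : Fin n → ℝ} (hr : r ∈ ({φ p, φ μ} : Set (Fin n → ℝ))) : φ z ≠ r := by
    rintro rfl
    exact hzs (hφz ▸ Submodule.subset_span hr)
  rcases notMem_span_pair_or (hφ hp.1) (hφ hμ.1) hx hpμ hzs hxs with h | h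
  · exact hB.eq_self_of_notMem_span hφ hz hp hx (hzne (by simp)) (by rwa [hφz])
  · exact hB.eq_self_of_notMem_span hφ hz hμ hx (hzne (by simp)) (by rwa [hφz])
end

section
/- Let n ≥ 3, let Δ be the standard simplex of probability vectors on Fin n, and fix a prior μ in the relative interior of Δ. Suppose a distortion function φ : Δ → Δ respects the Blackwell order for μ, produces no expansive error at any point of Δ (i.e., φ(x) ∈ segment ℝ μ x for all x ∈ Δ), and produces a contractive error at some point (i.e., there exists x ∈ Δ with φ(x) ∈ segment ℝ μ x and φ(x) ≠ x). Then φ(x) = μ for every x in the relative interior of Δ. -/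
open Set Finset

open Filter Topology

/-- A point outside the span of `{a, b}` can be given a prescribed value by a linear form,
independently of the values at `a` and `b`. -/
lemma exists_dotProduct_eq_of_notMem_span {n : ℕ} {a b z : Fin n → ℝ}
    (hab : LinearIndependent ℝ ![a, b]) (hz : z ∉ Submodule.span ℝ {a, b}) (p q r : ℝ) :
    ∃ v : Fin n → ℝ, a ⬝ᵥ v = p ∧ b ⬝ᵥ v = q ∧ z ⬝ᵥ v = r := by
  have hli : LinearIndependent ℝ ![z, a, b] := by
    refine linearIndependent_finCons.2 ⟨hab, ?_⟩
    simpa [Matrix.range_cons, Set.pair_comm] using hz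
  obtain ⟨f, hf⟩ : ∃ f : (Fin n → ℝ) →ₗ[ℝ] ℝ, ∀ i, f (![z, a, b] i) = ![r, p, q] i := by
    obtain ⟨g, hg⟩ := ((Module.Basis.span hli).constr ℝ ![r, p, q]).exists_extend
    refine ⟨g, fun i => ?_⟩
    have h := LinearMap.congr_fun hg (Module.Basis.span hli i)
    rw [Module.Basis.constr_basis] at h
    rw [← h]
    simp [Module.Basis.span_apply]
  have key : ∀ w : Fin n → ℝ, (w ⬝ᵥ fun i => f fun j => if i = j then 1 else 0) = f w :=
    fun w => (LinearMap.pi_apply_eq_sum_univ f w).symm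
  exact ⟨_, (key a).trans (hf 1), (key b).trans (hf 2), (key z).trans (hf 0)⟩

/-- A simplex point other than `a` is not a multiple of `a`. -/
lemma linearIndependent_pair_of_mem_stdSimplex {n : ℕ} {a b : Fin n → ℝ}
    (ha : a ∈ stdSimplex ℝ (Fin n)) (hb : b ∈ stdSimplex ℝ (Fin n)) (hab : b ≠ a) :
    LinearIndependent ℝ ![a, b] := by
  have ha0 : a ≠ 0 := by
    rintro rfl
    simpa using ha.2
  refine (LinearIndependent.pair_iff' ha0).2 fun c hc => hab ?_
  have h := hb.2
  rw [← hc] at h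
  simp only [Pi.smul_apply, smul_eq_mul, ← Finset.mul_sum, ha.2, mul_one] at h
  rw [← hc, h, one_smul]

/-- From a full-support point one can move a little in any sum-zero direction while
staying in the simplex and keeping a linear form positive. -/
lemma exists_add_smul_mem_relintSimplex {n : ℕ} {x d v : Fin n → ℝ} (hx : x ∈ relintSimplex n)
    (hd : ∑ θ, d θ = 0) (hv : 0 < x ⬝ᵥ v) :
    ∃ δ : ℝ, 0 < δ ∧ x + δ • d ∈ relintSimplex n ∧ 0 < (x + δ • d) ⬝ᵥ v := by
  have h1 : ∀ θ, ∀ᶠ δ : ℝ in 𝓝[>] 0, 0 < x θ + δ * d θ := fun θ => by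
    have hc : Continuous fun δ : ℝ => x θ + δ * d θ := by fun_prop
    exact (hc.continuousAt.eventually_const_lt (by simpa using hx.2 θ)).filter_mono
      nhdsWithin_le_nhds
  have h2 : ∀ᶠ δ : ℝ in 𝓝[>] 0, 0 < x ⬝ᵥ v + δ * (d ⬝ᵥ v) := by
    have hc : Continuous fun δ : ℝ => x ⬝ᵥ v + δ * (d ⬝ᵥ v) := by fun_prop
    exact (hc.continuousAt.eventually_const_lt (by simpa using hv)).filter_mono
      nhdsWithin_le_nhds
  obtain ⟨δ, ⟨hδ1, hδ2⟩, hδ⟩ :=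
    (((eventually_all.2 h1).and h2).and self_mem_nhdsWithin).exists
  refine ⟨δ, hδ, ⟨⟨fun θ => (hδ1 θ).le, ?_⟩, hδ1⟩, ?_⟩
  · simp [Finset.sum_add_distrib, ← Finset.mul_sum, hd, hx.1.2]
  · simpa [add_dotProduct, smul_dotProduct] using hδ2

/-- In the binary problem of accepting or rejecting a gamble `v`, if some full-support belief
rightly accepts, then every belief that should accept does. -/
lemma RespectsBlackwell.dotProduct_pos {n : ℕ} {φ : (Fin n → ℝ) → (Fin n → ℝ)}
    (hB : RespectsBlackwell n φ) {x y v : Fin n → ℝ} (hx : x ∈ relintSimplex n)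
    (hy : y ∈ stdSimplex ℝ (Fin n)) (hxv : 0 < x ⬝ᵥ v) (hyv : 0 < y ⬝ᵥ v)
    (hφx : 0 < φ x ⬝ᵥ v) : 0 < φ y ⬝ᵥ v := by
  by_contra hφy
  classical
  have hW := hB Bool (fun b => if b then v else 0) continuous_of_discreteTopology
    (fun w => decide (0 < w ⬝ᵥ v)) (by
      intro w _ b
      change w ⬝ᵥ (if b then v else 0) ≤ w ⬝ᵥ (if decide (0 < w ⬝ᵥ v) then v else 0)
      by_cases hw : 0 < w ⬝ᵥ v <;> cases b <;> simp [hw] <;> linarith)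
  obtain ⟨δ, hδ, hz, hzv⟩ := exists_add_smul_mem_relintSimplex (d := x - y) hx
    (by simp [Finset.sum_sub_distrib, hx.1.2, hy.2]) hxv
  set z := x + δ • (x - y) with hz_def
  have hcomb : (1 / (1 + δ)) • z + (δ / (1 + δ)) • y = x := by
    ext θ
    simp only [hz_def, Pi.add_apply, Pi.smul_apply, Pi.sub_apply, smul_eq_mul]
    field_simp
    ring
  have h := hW.2 hz.1 hy (show 0 ≤ 1 / (1 + δ) by positivity)
    (show 0 ≤ δ / (1 + δ) by positivity) (by field_simp)
  rw [hcomb] at h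
  change x ⬝ᵥ (if decide (0 < φ x ⬝ᵥ v) then v else 0) ≤
    1 / (1 + δ) * (z ⬝ᵥ (if decide (0 < φ z ⬝ᵥ v) then v else 0)) +
    δ / (1 + δ) * (y ⬝ᵥ (if decide (0 < φ y ⬝ᵥ v) then v else 0)) at h
  have hzW : z ⬝ᵥ (if decide (0 < φ z ⬝ᵥ v) then v else 0) ≤ z ⬝ᵥ v := by
    by_cases hw : 0 < φ z ⬝ᵥ v <;> simp [hw, hzv.le]
  have hxeq : x ⬝ᵥ v = 1 / (1 + δ) * (z ⬝ᵥ v) + δ / (1 + δ) * (y ⬝ᵥ v) := by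
    conv_lhs => rw [← hcomb]
    simp [add_dotProduct, smul_dotProduct]
  simp only [hφx, hφy, decide_true, decide_false, if_true, Bool.false_eq_true, if_false,
    dotProduct_zero, mul_zero, add_zero] at h
  have h3 := mul_le_mul_of_nonneg_left hzW (show 0 ≤ 1 / (1 + δ) by positivity)
  have h4 : 0 < δ / (1 + δ) * (y ⬝ᵥ v) := by positivity
  linarith

/-- If `y` is distorted towards `μ`, then every full-support `x` whose payoff can be chosen
independently of those at `μ` and `y` is distorted all the way to `μ`. -/
lemma RespectsBlackwell.eq_prior {n : ℕ} {φ : (Fin n → ℝ) → (Fin n → ℝ)}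
    (hB : RespectsBlackwell n φ) {μ x y : Fin n → ℝ} (hx : x ∈ relintSimplex n)
    (hy : y ∈ stdSimplex ℝ (Fin n)) (hφx : φ x ∈ segment ℝ μ x) (hφy : φ y ∈ segment ℝ μ y)
    (hne : φ y ≠ y)
    (hv : ∀ p q r : ℝ, ∃ v : Fin n → ℝ, μ ⬝ᵥ v = p ∧ y ⬝ᵥ v = q ∧ x ⬝ᵥ v = r) :
    φ x = μ := by
  obtain ⟨s, t, hs, ht, hst, hx'⟩ := hφx
  obtain ⟨s', t', hs', ht', hst', hy'⟩ := hφy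
  rcases ht.eq_or_lt with rfl | ht0
  · rw [← hx', show s = 1 by linarith]
    simp
  rcases hs'.eq_or_lt with rfl | hs0'
  · exact absurd (by rw [← hy', show t' = 1 by linarith]; simp) hne
  obtain ⟨v, hμv, hyv, hxv⟩ := hv (-1) s' ((s + 1) / t)
  have h := hB.dotProduct_pos (v := v) hx hy (by rw [hxv]; positivity) (by rwa [hyv]) (by
    rw [← hx', add_dotProduct, smul_dotProduct, smul_dotProduct, hμv, hxv, smul_eq_mul,
      smul_eq_mul, mul_div_cancel₀ _ ht0.ne']
    linarith)
  rw [← hy', add_dotProduct, smul_dotProduct, smul_dotProduct, hμv, hyv, smul_eq_mul,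
    smul_eq_mul] at h
  nlinarith

/-- In dimension at least three, some full-support belief lies off any given line through
a full-support belief. -/
lemma exists_mem_relintSimplex_notMem_span {n : ℕ} (hn : 3 ≤ n) {μ y : Fin n → ℝ}
    (hμ : μ ∈ relintSimplex n) :
    ∃ z ∈ relintSimplex n, z ∉ Submodule.span ℝ {μ, y} := by
  obtain ⟨w, hw⟩ : ∃ w : Fin n → ℝ, w ∉ Submodule.span ℝ {μ, y} := by
    by_contra! h
    have htop := (Submodule.eq_top_iff'.2 h)
    have hle := finrank_span_finset_le_card (R := ℝ) ({μ, y} : Finset (Fin n → ℝ))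
    have hcard := Finset.card_le_two (a := μ) (b := y)
    rw [Finset.coe_insert, Finset.coe_singleton, Set.finrank, htop, finrank_top,
      Module.finrank_fin_fun] at hle
    omega
  have hμmem : μ ∈ Submodule.span ℝ {μ, y} := Submodule.subset_span (by simp)
  obtain ⟨δ, hδ, hz, -⟩ := exists_add_smul_mem_relintSimplex (d := w - (∑ θ, w θ) • μ)
    (v := 1) hμ (by simp [Finset.sum_sub_distrib, ← Finset.mul_sum, hμ.1.2])
    (by simp [dotProduct_one, hμ.1.2])
  refine ⟨_, hz, fun h => hw ?_⟩
  rw [Submodule.add_mem_iff_right _ hμmem, Submodule.smul_mem_iff _ hδ.ne',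
    Submodule.sub_mem_iff_left _ (Submodule.smul_mem _ _ hμmem)] at h
  exact h


theorem contractive_error_implies_prior
    (n : ℕ) (hn : 3 ≤ n)
    (μ : Fin n → ℝ) (hμ : μ ∈ relintSimplex n)
    (φ : (Fin n → ℝ) → (Fin n → ℝ))
    (hφ : MapsTo φ (stdSimplex ℝ (Fin n)) (stdSimplex ℝ (Fin n)))
    (hB : RespectsBlackwell n φ)
    (hnoexp : ∀ x ∈ stdSimplex ℝ (Fin n), φ x ∈ segment ℝ μ x)
    (hcon : ∃ x ∈ stdSimplex ℝ (Fin n), φ x ∈ segment ℝ μ x ∧ φ x ≠ x) :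
    ∀ x ∈ relintSimplex n, φ x = μ := by
  obtain ⟨y, hy, -, hne⟩ := hcon
  have seg_self : φ μ = μ := by simpa using hnoexp μ hμ.1
  have hyμ : y ≠ μ := by
    rintro rfl
    exact hne seg_self
  have hli := linearIndependent_pair_of_mem_stdSimplex hμ.1 hy hyμ
  have off_line : ∀ z ∈ relintSimplex n, z ∉ Submodule.span ℝ {μ, y} → φ z = μ :=
    fun z hz hzs => hB.eq_prior hz hy (hnoexp z hz.1) (hnoexp y hy) hne
      (exists_dotProduct_eq_of_notMem_span hli hzs)
  intro x hx
  by_cases hxs : x ∈ Submodule.span ℝ {μ, y}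
  swap
  · exact off_line x hx hxs
  by_cases hxμ : x = μ
  · rw [hxμ, seg_self]
  have hμmem : μ ∈ Submodule.span ℝ {μ, y} := Submodule.subset_span (by simp)
  obtain ⟨z, hz, hzs⟩ := exists_mem_relintSimplex_notMem_span hn hμ (y := y)
  have hφz := off_line z hz hzs
  refine hB.eq_prior hx hz.1 (hnoexp x hx.1) (hnoexp z hz.1) ?_ fun p q r => ?_
  · rw [hφz]
    rintro rfl
    exact hzs hμmem
  · have hzx : z ∉ Submodule.span ℝ {μ, x} := fun h =>
      hzs (Submodule.span_le.2 (Set.pair_subset hμmem hxs) h)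
    obtain ⟨v, h1, h2, h3⟩ := exists_dotProduct_eq_of_notMem_span
      (linearIndependent_pair_of_mem_stdSimplex hμ.1 hx.1 hxμ) hzx p r q
    exact ⟨v, h1, h3, h2⟩
end
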